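/- Let Λ ⊆ ℝ^n be a lattice with smoothing parameter η_ε(Λ) and let s ≥ η_ε(Λ) with ε < 1/2. Then for every shift v ∈ ℝ^n, the ratio ρ_{s,0}(Λ)/ρ_{s,−v}(Λ) lies in the interval [1, (1+ε)/(1−ε)] ⊆ [1, 1+4ε]. -/

import Mathlib

open scoped BigOperators Real

noncomputable section

/-- The lattice generated by the columns of `B`. -/
def latticeSet {n : ℕ} (B : Matrix (Fin n) (Fin n) ℝ) : Set (Fin n → ℝ) :=
  {x | ∃ z : Fin n → ℤ, x = B.mulVec fun i => (z i : ℝ)}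

/-- The dual lattice. -/
def dualLattice {n : ℕ} (B : Matrix (Fin n) (Fin n) ℝ) : Set (Fin n → ℝ) :=
  {x | ∀ v ∈ latticeSet B, ∃ k : ℤ, (∑ i, x i * v i) = (k : ℝ)}

/-- Gaussian mass `ρ_{s,0}(S)` of a set `S ⊆ ℝ^n`. -/
def rhoOnSet {n : ℕ} (s : ℝ) (S : Set (Fin n → ℝ)) : ℝ :=
  ∑' x : S, Real.exp (-π * (∑ i, (x : Fin n → ℝ) i ^ 2) / s ^ 2)

/-- The smoothing parameter `η_ε(L(B))`. -/
def smoothingParam {n : ℕ} (B : Matrix (Fin n) (Fin n) ℝ) (ε : ℝ) : ℝ :=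
  sInf {s : ℝ | 0 < s ∧ rhoOnSet (1 / s) (dualLattice B \ {0}) ≤ ε}

/-- Shifted Gaussian mass `ρ_{s,c}(L(B)) = ∑_{x ∈ L(B)} exp(−π‖x−c‖²/s²)`. -/
def rhoCentered {n : ℕ} (B : Matrix (Fin n) (Fin n) ℝ) (s : ℝ) (c : Fin n → ℝ) : ℝ :=
  ∑' z : Fin n → ℤ,
    Real.exp (-π * (∑ i, ((B.mulVec fun j => (z j : ℝ)) i - c i) ^ 2) / s ^ 2)

/-- The quadratic form `‖B x‖²`. -/
def qf {n : ℕ} (B : Matrix (Fin n) (Fin n) ℝ) (x : Fin n → ℝ) : ℝ :=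
  ∑ i, (B.mulVec x) i ^ 2

lemma qf_nonneg {n : ℕ} (B : Matrix (Fin n) (Fin n) ℝ) (x : Fin n → ℝ) : 0 ≤ qf B x :=
  Finset.sum_nonneg fun i _ => sq_nonneg _

lemma qf_zero {n : ℕ} (B : Matrix (Fin n) (Fin n) ℝ) : qf B 0 = 0 := by simp [qf]

lemma qf_neg {n : ℕ} (B : Matrix (Fin n) (Fin n) ℝ) (x : Fin n → ℝ) : qf B (-x) = qf B x := by
  simp [qf, Matrix.mulVec_neg]

lemma qf_continuous {n : ℕ} (B : Matrix (Fin n) (Fin n) ℝ) : Continuous (qf B) := by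
  unfold qf
  fun_prop

lemma qf_le {n : ℕ} (B : Matrix (Fin n) (Fin n) ℝ) (x : Fin n → ℝ) :
    qf B x ≤ ((∑ i, ∑ j, B i j ^ 2) + 1) * ∑ i, x i ^ 2 := by
  have h : qf B x ≤ (∑ i, ∑ j, B i j ^ 2) * ∑ i, x i ^ 2 := by
    unfold qf
    rw [Finset.sum_mul]
    refine Finset.sum_le_sum fun i _ => ?_
    exact Finset.sum_mul_sq_le_sq_mul_sq Finset.univ (B i) x
  have : 0 ≤ ∑ i, x i ^ 2 := Finset.sum_nonneg fun i _ => sq_nonneg _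
  linarith

lemma qf_lower {n : ℕ} (B : Matrix (Fin n) (Fin n) ℝ) (hB : IsUnit B.det) :
    ∃ c : ℝ, 0 < c ∧ ∀ x, c * ∑ i, x i ^ 2 ≤ qf B x := by
  have hC : 0 < (∑ i, ∑ j, B⁻¹ i j ^ 2) + 1 := by
    have : 0 ≤ (∑ i, ∑ j, B⁻¹ i j ^ 2) := by positivity
    linarith
  refine ⟨((∑ i, ∑ j, B⁻¹ i j ^ 2) + 1)⁻¹, inv_pos.2 hC, fun x => ?_⟩
  have h := qf_le B⁻¹ (B.mulVec x)
  have h2 : qf B⁻¹ (B.mulVec x) = ∑ i, x i ^ 2 := by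
    simp [qf, Matrix.mulVec_mulVec, Matrix.nonsing_inv_mul B hB]
  rw [h2] at h
  rw [inv_mul_le_iff₀ hC]
  exact h

lemma qf_add_lower {n : ℕ} (B : Matrix (Fin n) (Fin n) ℝ) (x y : Fin n → ℝ) :
    qf B y / 2 - qf B x ≤ qf B (x + y) := by
  unfold qf
  rw [Finset.sum_div, ← Finset.sum_sub_distrib]
  refine Finset.sum_le_sum fun i _ => ?_
  rw [Matrix.mulVec_add, Pi.add_apply]
  nlinarith [sq_nonneg (2 * B.mulVec x i + B.mulVec y i)]

lemma summable_gauss_int {a : ℝ} (ha : 0 < a) :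
    Summable fun z : ℤ => Real.exp (-a * (z : ℝ) ^ 2) := by
  have h : Summable fun k : ℕ => Real.exp (-a * (k : ℝ) ^ 2) := by
    refine Real.summable_exp_nat_mul_of_ge (neg_lt_zero.2 ha) (f := fun k : ℕ => (k : ℝ) ^ 2) ?_
    intro i
    exact_mod_cast Nat.le_self_pow two_ne_zero i
  refine Summable.of_nat_of_neg (by simpa using h) (by simpa using h)

lemma summable_gauss_pi {a : ℝ} (ha : 0 < a) (n : ℕ) :
    Summable fun z : Fin n → ℤ => Real.exp (-a * ∑ i, (z i : ℝ) ^ 2) := by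
  induction n with
  | zero => exact (hasSum_fintype _).summable
  | succ m ih =>
    rw [← (Fin.consEquiv fun _ => ℤ).summable_iff]
    refine ((summable_gauss_int ha).mul_of_nonneg ih (fun _ => (Real.exp_pos _).le)
      (fun _ => (Real.exp_pos _).le)).congr fun z => ?_
    rw [← Real.exp_add]
    simp [Fin.sum_univ_succ, Fin.consEquiv]
    ring

lemma summable_qf {n : ℕ} (B : Matrix (Fin n) (Fin n) ℝ) (hB : IsUnit B.det) {a : ℝ}
    (ha : 0 < a) :
    Summable fun z : Fin n → ℤ => Real.exp (-a * qf B fun i => (z i : ℝ)) := by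
  obtain ⟨c, hc, h⟩ := qf_lower B hB
  refine (summable_gauss_pi (mul_pos ha hc) n).of_nonneg_of_le (fun _ => (Real.exp_pos _).le)
    fun z => Real.exp_le_exp.2 ?_
  nlinarith [h fun i => (z i : ℝ)]

/-- Integer vector as a real vector. -/
def zv {n : ℕ} (z : Fin n → ℤ) : Fin n → ℝ := fun i => (z i : ℝ)

lemma gauss_shift_le {n : ℕ} (B : Matrix (Fin n) (Fin n) ℝ) {a : ℝ}
    (ha : 0 < a) (t : Fin n → ℝ) (z : Fin n → ℤ) :
    Real.exp (-a * qf B (t + zv z)) ≤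
      Real.exp (-(a / 2) * qf B (zv z)) * Real.exp (a * qf B t) := by
  rw [← Real.exp_add]
  refine Real.exp_le_exp.2 ?_
  nlinarith [qf_add_lower B t (zv z)]

lemma summable_qf_shift {n : ℕ} (B : Matrix (Fin n) (Fin n) ℝ) (hB : IsUnit B.det) {a : ℝ}
    (ha : 0 < a) (t : Fin n → ℝ) :
    Summable fun z : Fin n → ℤ => Real.exp (-a * qf B (t + zv z)) :=
  ((summable_qf B hB (half_pos ha)).mul_right _).of_nonneg_of_le (fun _ => (Real.exp_pos _).le)
    fun z => gauss_shift_le B ha t z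

/-- Periodized Gaussian. -/
def pg {n : ℕ} (B : Matrix (Fin n) (Fin n) ℝ) (a : ℝ) (t : Fin n → ℝ) : ℝ :=
  ∑' z : Fin n → ℤ, Real.exp (-a * qf B (t + zv z))

lemma pg_continuous {n : ℕ} (B : Matrix (Fin n) (Fin n) ℝ) (hB : IsUnit B.det) {a : ℝ}
    (ha : 0 < a) : Continuous (pg B a) := by
  rw [continuous_iff_continuousAt]
  intro t₀
  have hU : IsOpen {t | qf B t < qf B t₀ + 1} := isOpen_lt (qf_continuous B) continuous_const
  have hmem : {t | qf B t < qf B t₀ + 1} ∈ nhds t₀ := hU.mem_nhds (by simp)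
  refine ContinuousOn.continuousAt (s := {t | qf B t < qf B t₀ + 1}) ?_ hmem
  unfold pg
  refine continuousOn_tsum (u := fun z => Real.exp (-(a / 2) * qf B (zv z)) *
    Real.exp (a * (qf B t₀ + 1))) ?_ ((summable_qf B hB (half_pos ha)).mul_right _) ?_
  · intro z
    have := qf_continuous B
    exact Continuous.continuousOn (by fun_prop)
  · intro z t ht
    rw [Real.norm_of_nonneg (Real.exp_pos _).le]
    refine (gauss_shift_le B ha t z).trans ?_
    have ht' : qf B t ≤ qf B t₀ + 1 := le_of_lt ht
    gcongr

lemma pg_add_int {n : ℕ} (B : Matrix (Fin n) (Fin n) ℝ) (a : ℝ) (t : Fin n → ℝ)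
    (w : Fin n → ℤ) : pg B a (t + zv w) = pg B a t := by
  unfold pg
  rw [← (Equiv.addLeft w).tsum_eq fun z => Real.exp (-a * qf B (t + zv z))]
  refine tsum_congr fun z => ?_
  congr 3
  ext i
  simp [zv]
  ring

/-- Periodized Gaussian on the torus. -/
def pgTorus {n : ℕ} (B : Matrix (Fin n) (Fin n) ℝ) (a : ℝ) (θ : UnitAddTorus (Fin n)) : ℂ :=
  (pg B a fun i => (AddCircle.equivIoc (1 : ℝ) 0 (θ i) : ℝ) : ℝ)

lemma pgTorus_mk {n : ℕ} (B : Matrix (Fin n) (Fin n) ℝ) (a : ℝ) (t : Fin n → ℝ) :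
    pgTorus B a (fun i => (t i : UnitAddCircle)) = (pg B a t : ℝ) := by
  unfold pgTorus
  have h : ∀ i, ∃ k : ℤ, (AddCircle.equivIoc (1 : ℝ) 0 (t i : UnitAddCircle) : ℝ) = t i + k := by
    intro i
    have h1 : ((AddCircle.equivIoc (1 : ℝ) 0 (t i : UnitAddCircle) : ℝ) : UnitAddCircle)
        = (t i : UnitAddCircle) :=
      (AddCircle.equivIoc (1 : ℝ) 0).symm_apply_apply _
    rw [← sub_eq_zero, ← AddCircle.coe_sub, AddCircle.coe_eq_zero_iff] at h1
    obtain ⟨k, hk⟩ := h1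
    refine ⟨k, ?_⟩
    simp at hk
    linarith
  choose k hk using h
  congr 1
  rw [← pg_add_int B a t k]
  congr 1
  ext i
  simp [hk, zv]

lemma pgTorus_continuous {n : ℕ} (B : Matrix (Fin n) (Fin n) ℝ) (hB : IsUnit B.det) {a : ℝ}
    (ha : 0 < a) : Continuous (pgTorus B a) := by
  have hq : IsOpenQuotientMap (Pi.map (fun (_ : Fin n) (x : ℝ) => (x : UnitAddCircle))) :=
    IsOpenQuotientMap.piMap fun _ => QuotientAddGroup.isOpenQuotientMap_mk
  rw [← hq.continuous_comp_iff]
  have : pgTorus B a ∘ (Pi.map (fun (_ : Fin n) (x : ℝ) => (x : UnitAddCircle))) =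
      fun t => ((pg B a t : ℝ) : ℂ) := by
    ext t
    exact pgTorus_mk B a t
  rw [this]
  exact Complex.continuous_ofReal.comp (pg_continuous B hB ha)

open MeasureTheory in
/-- Unfolding an integral over `ℝⁿ` to the unit cube. -/
lemma unfold_cube {n : ℕ} (f : (Fin n → ℝ) → ℂ) (hf : Integrable f) :
    ∫ x in {x : Fin n → ℝ | ∀ i, x i ∈ Set.Ioc (0 : ℝ) (0 + 1)}, ∑' z : Fin n → ℤ, f (x + zv z) =
      ∫ x, f x := by
  set Q : Set (Fin n → ℝ) := {x | ∀ i, x i ∈ Set.Ioc (0 : ℝ) (0 + 1)} with hQ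
  let S : (Fin n → ℤ) → Set (Fin n → ℝ) := fun z => {x | x - zv z ∈ Q}
  have hQm : MeasurableSet Q := by
    have : Q = Set.univ.pi fun _ => Set.Ioc (0 : ℝ) (0 + 1) := by
      ext x; simp [hQ]
    rw [this]
    exact MeasurableSet.univ_pi fun _ => measurableSet_Ioc
  have hSm : ∀ z, MeasurableSet (S z) := fun z => hQm.preimage (by fun_prop)
  have hSd : Pairwise (Function.onFun Disjoint S) := by
    intro z w hzw
    rw [Function.onFun, Set.disjoint_left]
    intro x hx hy
    apply hzw
    ext i
    have h1 := hx i
    have h2 := hy i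
    simp only [Pi.sub_apply, zv, Set.mem_Ioc, zero_add] at h1 h2
    have h3 : (z i : ℝ) < w i + 1 := by linarith
    have h4 : (w i : ℝ) < z i + 1 := by linarith
    norm_cast at h3 h4
    lia
  have hSu : ⋃ z, S z = Set.univ := by
    rw [Set.eq_univ_iff_forall]
    intro x
    refine Set.mem_iUnion.2 ⟨fun i => ⌈x i⌉ - 1, fun i => ?_⟩
    have h1 := Int.ceil_lt_add_one (x i)
    have h2 := Int.le_ceil (x i)
    simp only [Pi.sub_apply, zv, Set.mem_Ioc, zero_add]
    push_cast
    constructor <;> linarith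
  have key : ∀ {E : Type} [NormedAddCommGroup E] [NormedSpace ℝ E] (g : (Fin n → ℝ) → E)
      (z : Fin n → ℤ), ∫ x in S z, g x = ∫ x in Q, g (x + zv z) := by
    intro E _ _ g z
    have hmp := measurePreserving_add_right (volume : Measure (Fin n → ℝ)) (zv z)
    have := hmp.setIntegral_preimage_emb (measurableEmbedding_addRight (zv z)) g (S z)
    rw [← this]
    congr 2
    ext x
    simp [S]
  have hs1 := hasSum_integral_iUnion (μ := volume) (f := f) hSm hSd (by rw [hSu]; exact hf.integrableOn)
  have hs2 := hasSum_integral_iUnion (μ := volume) (f := fun x => ‖f x‖) hSm hSd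
    (by rw [hSu]; exact hf.norm.integrableOn)
  rw [hSu, Measure.restrict_univ] at hs1 hs2
  simp only [key] at hs1 hs2
  have hint : ∀ z : Fin n → ℤ, Integrable (fun x => f (x + zv z)) (volume.restrict Q) :=
    fun z => (hf.comp_add_right (zv z)).integrableOn
  have := hasSum_integral_of_summable_integral_norm hint hs2.summable
  exact this.unique hs1

open MeasureTheory in
lemma integral_comp_matrix {n : ℕ} (B : Matrix (Fin n) (Fin n) ℝ) (hB : IsUnit B.det)
    (f : (Fin n → ℝ) → ℂ) (hc : Continuous f) (hf : Integrable f) :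
    Integrable (fun x => f (B.mulVec x)) ∧
      ∫ x, f (B.mulVec x) = ((|B.det⁻¹| : ℝ) : ℂ) * ∫ x, f x := by
  have hm := Real.map_matrix_volume_pi_eq_smul_volume_pi hB.ne_zero
  have hmeas : AEMeasurable (Matrix.toLin' B) (volume : Measure (Fin n → ℝ)) := by
    have : Continuous (Matrix.toLin' B) := LinearMap.continuous_of_finiteDimensional _
    exact this.measurable.aemeasurable
  constructor
  · have h : Integrable f (Measure.map (Matrix.toLin' B) volume) := by
      rw [hm]
      exact hf.smul_measure ENNReal.ofReal_ne_top
    exact (integrable_map_measure hc.aestronglyMeasurable hmeas).1 h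
  · have h := integral_map hmeas (f := f) hc.aestronglyMeasurable
    rw [hm, integral_smul_measure, ENNReal.toReal_ofReal (abs_nonneg _)] at h
    simp only [Matrix.toLin'_apply] at h
    rw [← h]
    simp

lemma mFourier_mk {n : ℕ} (k : Fin n → ℤ) (x : Fin n → ℝ) :
    UnitAddTorus.mFourier k (fun i => (x i : UnitAddCircle)) =
      Complex.exp (2 * π * Complex.I * ∑ i, (k i : ℂ) * (x i : ℂ)) := by
  simp only [UnitAddTorus.mFourier, ContinuousMap.coe_mk]
  rw [Finset.mul_sum, Complex.exp_sum]
  refine Finset.prod_congr rfl fun i _ => ?_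
  rw [fourier_coe_apply]
  congr 1
  push_cast
  ring

lemma mFourier_mk_add {n : ℕ} (k : Fin n → ℤ) (x : Fin n → ℝ) (z : Fin n → ℤ) :
    UnitAddTorus.mFourier k (fun i => ((x + zv z) i : UnitAddCircle)) =
      UnitAddTorus.mFourier k (fun i => (x i : UnitAddCircle)) := by
  congr 1
  ext i
  rw [Pi.add_apply, AddCircle.coe_add]
  have : ((zv z i : ℝ) : UnitAddCircle) = 0 := by
    rw [AddCircle.coe_eq_zero_iff]
    exact ⟨z i, by simp [zv]⟩
  rw [this, add_zero]

/-- The constant in the Poisson summation formula. -/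
def pcst {n : ℕ} (B : Matrix (Fin n) (Fin n) ℝ) (a : ℝ) : ℝ :=
  |B.det⁻¹| * (π / a) ^ ((n : ℝ) / 2)

open MeasureTheory in
lemma gauss_fourier {n : ℕ} (B : Matrix (Fin n) (Fin n) ℝ) (hB : IsUnit B.det) {a : ℝ}
    (ha : 0 < a) (k : Fin n → ℤ) :
    Integrable (fun x : Fin n → ℝ => UnitAddTorus.mFourier (-k) (fun i => (x i : UnitAddCircle)) *
        ((Real.exp (-a * qf B x) : ℝ) : ℂ)) ∧
    ∫ x : Fin n → ℝ, UnitAddTorus.mFourier (-k) (fun i => (x i : UnitAddCircle)) *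
        ((Real.exp (-a * qf B x) : ℝ) : ℂ) =
      ((pcst B a * Real.exp (-(π ^ 2 / a) * qf (B⁻¹).transpose (zv k)) : ℝ) : ℂ) := by
  set w : Fin n → ℝ := (B⁻¹).transpose.mulVec (zv k) with hw
  let c : Fin n → ℂ := fun i => -(2 * π * Complex.I * (w i : ℂ))
  let h : (Fin n → ℝ) → ℂ := fun y =>
    Complex.exp (-(a : ℂ) * ∑ i, (y i : ℂ) ^ 2 + ∑ i, c i * (y i : ℂ))
  have hre : 0 < (a : ℂ).re := by simpa using ha
  have hint : Integrable h := GaussianFourier.integrable_cexp_neg_mul_sum_add hre c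
  have hcont : Continuous h := by
    simp only [h]
    fun_prop
  have hval : ∫ y, h y = _ := GaussianFourier.integral_cexp_neg_mul_sum_add hre c
  have hfun : (fun x : Fin n → ℝ => UnitAddTorus.mFourier (-k) (fun i => (x i : UnitAddCircle)) *
        ((Real.exp (-a * qf B x) : ℝ) : ℂ)) = fun x => h (B.mulVec x) := by
    ext x
    rw [mFourier_mk, Complex.ofReal_exp, ← Complex.exp_add]
    simp only [h]
    congr 1
    have hdot : ∑ i, w i * (B.mulVec x) i = ∑ i, (k i : ℝ) * x i := by
      have : dotProduct w (B.mulVec x) = dotProduct (zv k) x := by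
        rw [hw, Matrix.mulVec_transpose, ← Matrix.dotProduct_mulVec, Matrix.mulVec_mulVec,
          Matrix.nonsing_inv_mul B hB, Matrix.one_mulVec]
      exact this
    have hdot' : ∑ i, (w i : ℂ) * ((B.mulVec x) i : ℂ) = ∑ i, (k i : ℂ) * (x i : ℂ) := by
      exact_mod_cast congrArg (fun r : ℝ => (r : ℂ)) hdot
    have hcs : ∑ i, c i * ((B.mulVec x) i : ℂ) =
        -(2 * π * Complex.I) * ∑ i, (k i : ℂ) * (x i : ℂ) := by
      rw [← hdot', Finset.mul_sum]
      refine Finset.sum_congr rfl fun i _ => ?_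
      simp only [c]
      ring
    rw [hcs]
    simp only [Pi.neg_apply, Int.cast_neg, neg_mul, Finset.sum_neg_distrib, qf]
    push_cast
    ring
  obtain ⟨hi, hv⟩ := integral_comp_matrix B hB h hcont hint
  rw [hfun]
  refine ⟨hi, ?_⟩
  rw [hv, hval]
  have hsum : (∑ i, c i ^ 2) / (4 * (a : ℂ)) =
      ((-(π ^ 2 / a) * qf (B⁻¹).transpose (zv k) : ℝ) : ℂ) := by
    have : ∑ i, c i ^ 2 = -(4 * (π : ℂ) ^ 2) * ((qf (B⁻¹).transpose (zv k) : ℝ) : ℂ) := by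
      simp only [qf, ← hw]
      push_cast
      rw [Finset.mul_sum]
      refine Finset.sum_congr rfl fun i _ => ?_
      simp only [c]
      ring_nf
      rw [Complex.I_sq]
      ring
    rw [this]
    have ha' : (a : ℂ) ≠ 0 := by exact_mod_cast ha.ne'
    push_cast
    field_simp
  rw [hsum, pcst]
  have hp : ((π : ℂ) / (a : ℂ)) ^ ((Fintype.card (Fin n) : ℂ) / 2) =
      (((π / a) ^ ((n : ℝ) / 2) : ℝ) : ℂ) := by
    rw [Complex.ofReal_cpow (by positivity)]
    simp
  rw [hp]
  push_cast
  ring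

lemma pg_coeff {n : ℕ} (B : Matrix (Fin n) (Fin n) ℝ) (hB : IsUnit B.det) {a : ℝ}
    (ha : 0 < a) (k : Fin n → ℤ) :
    UnitAddTorus.mFourierCoeff (pgTorus B a) k =
      ((pcst B a * Real.exp (-(π ^ 2 / a) * qf (B⁻¹).transpose (zv k)) : ℝ) : ℂ) := by
  obtain ⟨hi, hv⟩ := gauss_fourier B hB ha k
  rw [UnitAddTorus.mFourierCoeff_eq_integral _ k (fun _ => 0), ← hv, ← unfold_cube _ hi]
  congr 1
  ext x
  rw [pgTorus_mk, pg, Complex.ofReal_tsum, smul_eq_mul, ← tsum_mul_left]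
  refine tsum_congr fun z => ?_
  rw [mFourier_mk_add]

lemma isUnit_dual {n : ℕ} (B : Matrix (Fin n) (Fin n) ℝ) (hB : IsUnit B.det) :
    IsUnit (B⁻¹).transpose.det := by
  rw [Matrix.det_transpose]
  exact Matrix.isUnit_nonsing_inv_det B hB

lemma poisson {n : ℕ} (B : Matrix (Fin n) (Fin n) ℝ) (hB : IsUnit B.det) {a : ℝ}
    (ha : 0 < a) (t : Fin n → ℝ) :
    HasSum (fun k : Fin n → ℤ => pcst B a * (Real.exp (-(π ^ 2 / a) * qf (B⁻¹).transpose (zv k)) *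
      Real.cos (2 * π * ∑ i, (k i : ℝ) * t i))) (pg B a t) := by
  let F : C(UnitAddTorus (Fin n), ℂ) := ⟨pgTorus B a, pgTorus_continuous B hB ha⟩
  have hsum : Summable (UnitAddTorus.mFourierCoeff F) := by
    have : UnitAddTorus.mFourierCoeff F = fun k => ((pcst B a *
        Real.exp (-(π ^ 2 / a) * qf (B⁻¹).transpose (zv k)) : ℝ) : ℂ) := by
      ext k
      exact pg_coeff B hB ha k
    rw [this, Complex.summable_ofReal]
    exact (summable_qf _ (isUnit_dual B hB) (by positivity)).mul_left _
  have h := UnitAddTorus.hasSum_mFourier_series_apply_of_summable hsum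
    (fun i => (t i : UnitAddCircle))
  have h2 := Complex.hasSum_re h
  have hF : F (fun i => (t i : UnitAddCircle)) = ((pg B a t : ℝ) : ℂ) := pgTorus_mk B a t
  rw [hF, Complex.ofReal_re] at h2
  refine h2.congr_fun fun k => ?_
  have hk : UnitAddTorus.mFourierCoeff F k = _ := pg_coeff B hB ha k
  rw [hk, smul_eq_mul, Complex.re_ofReal_mul, mFourier_mk]
  have : (2 * π * Complex.I * ∑ i, (k i : ℂ) * (t i : ℂ)) =
      ((2 * π * ∑ i, (k i : ℝ) * t i : ℝ) : ℂ) * Complex.I := by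
    push_cast
    ring
  rw [this, Complex.exp_ofReal_mul_I_re]
  ring

/-- The dual lattice without `0`, parametrized by nonzero integer vectors. -/
lemma dual_mem {n : ℕ} (B : Matrix (Fin n) (Fin n) ℝ) (hB : IsUnit B.det) (k : Fin n → ℤ) :
    (B⁻¹).transpose.mulVec (zv k) ∈ dualLattice B := by
  rintro v ⟨z, rfl⟩
  refine ⟨∑ i, k i * z i, ?_⟩
  have : dotProduct ((B⁻¹).transpose.mulVec (zv k)) (B.mulVec (zv z)) = dotProduct (zv k) (zv z) := by
    rw [Matrix.mulVec_transpose, ← Matrix.dotProduct_mulVec, Matrix.mulVec_mulVec,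
      Matrix.nonsing_inv_mul B hB, Matrix.one_mulVec]
  push_cast
  exact this

lemma dual_inj {n : ℕ} (B : Matrix (Fin n) (Fin n) ℝ) (hB : IsUnit B.det) (k l : Fin n → ℤ)
    (h : (B⁻¹).transpose.mulVec (zv k) = (B⁻¹).transpose.mulVec (zv l)) : k = l := by
  have h2 : zv k = zv l := by
    have := congrArg (fun y => B.transpose.mulVec y) h
    simpa only [Matrix.mulVec_mulVec, ← Matrix.transpose_mul, Matrix.nonsing_inv_mul B hB,
      Matrix.transpose_one, Matrix.one_mulVec] using this
  ext i
  have := congrFun h2 i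
  simpa [zv] using this

lemma dual_surj {n : ℕ} (B : Matrix (Fin n) (Fin n) ℝ) (hB : IsUnit B.det) (x : Fin n → ℝ)
    (hx : x ∈ dualLattice B) : ∃ k : Fin n → ℤ, (B⁻¹).transpose.mulVec (zv k) = x := by
  have h : ∀ j, ∃ k : ℤ, (B.transpose.mulVec x) j = k := by
    intro j
    obtain ⟨k, hk⟩ := hx (B.mulVec fun i => ((Pi.single j 1 : Fin n → ℤ) i : ℝ)) ⟨_, rfl⟩
    refine ⟨k, ?_⟩
    rw [← hk]
    have h1 : (fun i => ((Pi.single j 1 : Fin n → ℤ) i : ℝ)) = Pi.single j 1 := by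
      ext i
      by_cases hij : i = j
      · subst hij; simp
      · simp [hij]
    rw [h1]
    simp [Matrix.mulVec, dotProduct, Matrix.transpose_apply, Pi.single_apply, mul_comm]
  choose k hk using h
  refine ⟨k, ?_⟩
  have : zv k = B.transpose.mulVec x := by
    ext i
    simp [zv, hk]
  rw [this, Matrix.mulVec_mulVec, ← Matrix.transpose_mul, Matrix.mul_nonsing_inv B hB,
    Matrix.transpose_one, Matrix.one_mulVec]

/-- Dual Gaussian mass of nonzero integer vectors. -/
def dm {n : ℕ} (B : Matrix (Fin n) (Fin n) ℝ) (s : ℝ) : ℝ :=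
  ∑' k : {k : Fin n → ℤ // k ≠ 0}, Real.exp (-(π * s ^ 2) * qf (B⁻¹).transpose (zv k.1))

lemma zv_zero {n : ℕ} : zv (0 : Fin n → ℤ) = 0 := by
  ext i
  simp [zv]

lemma rho_dual {n : ℕ} (B : Matrix (Fin n) (Fin n) ℝ) (hB : IsUnit B.det) (s : ℝ) :
    rhoOnSet (1 / s) (dualLattice B \ {0}) = dm B s := by
  let f : {k : Fin n → ℤ // k ≠ 0} → ↥(dualLattice B \ {0}) := fun k =>
    ⟨(B⁻¹).transpose.mulVec (zv k.1), dual_mem B hB k.1, fun h => k.2 (dual_inj B hB _ _ (by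
      rw [zv_zero, Matrix.mulVec_zero]; exact h))⟩
  have hf : Function.Bijective f := by
    constructor
    · intro k l h
      exact Subtype.ext (dual_inj B hB _ _ (congrArg Subtype.val h))
    · rintro ⟨x, hx, hx0⟩
      obtain ⟨k, rfl⟩ := dual_surj B hB x hx
      refine ⟨⟨k, fun h => hx0 ?_⟩, rfl⟩
      rw [h, zv_zero, Matrix.mulVec_zero]
      rfl
  unfold rhoOnSet dm
  rw [← (Equiv.ofBijective f hf).tsum_eq]
  refine tsum_congr fun k => ?_
  simp only [Equiv.ofBijective_apply, f, qf]
  congr 1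
  rw [one_div, inv_pow, div_inv_eq_mul]
  ring

lemma dm_summable {n : ℕ} (B : Matrix (Fin n) (Fin n) ℝ) (hB : IsUnit B.det) {s : ℝ}
    (hs : 0 < s) : Summable fun k : {k : Fin n → ℤ // k ≠ 0} =>
      Real.exp (-(π * s ^ 2) * qf (B⁻¹).transpose (zv k.1)) :=
  (summable_qf _ (isUnit_dual B hB) (by positivity)).subtype _

lemma dm_anti {n : ℕ} (B : Matrix (Fin n) (Fin n) ℝ) (hB : IsUnit B.det) {s t : ℝ}
    (hs : 0 < s) (hst : s ≤ t) : dm B t ≤ dm B s := by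
  refine Summable.tsum_le_tsum (fun k => Real.exp_le_exp.2 ?_)
    (dm_summable B hB (hs.trans_le hst)) (dm_summable B hB hs)
  have h := qf_nonneg (B⁻¹).transpose (zv k.1)
  have : π * s ^ 2 ≤ π * t ^ 2 := by gcongr
  nlinarith

lemma dm_tendsto {n : ℕ} (B : Matrix (Fin n) (Fin n) ℝ) (hB : IsUnit B.det) :
    Filter.Tendsto (dm B) Filter.atTop (nhds 0) := by
  have h0 : (0 : ℝ) = ∑' _ : {k : Fin n → ℤ // k ≠ 0}, (0 : ℝ) := by simp
  rw [h0]
  refine tendsto_tsum_of_dominated_convergence (dm_summable B hB one_pos) ?_ ?_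
  · intro k
    obtain ⟨c, hc, h⟩ := qf_lower _ (isUnit_dual B hB)
    have hpos : 0 < qf (B⁻¹).transpose (zv k.1) := by
      refine lt_of_lt_of_le (mul_pos hc ?_) (h _)
      obtain ⟨i, hi⟩ := Function.ne_iff.1 k.2
      refine Finset.sum_pos' (fun _ _ => sq_nonneg _) ⟨i, Finset.mem_univ _, ?_⟩
      have : (zv k.1 i) ≠ 0 := by simpa [zv] using hi
      positivity
    refine Real.tendsto_exp_atBot.comp ?_
    have h1 : Filter.Tendsto (fun s : ℝ => s ^ 2) Filter.atTop Filter.atTop :=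
      Filter.tendsto_pow_atTop two_ne_zero
    have h2 : Filter.Tendsto (fun s : ℝ => -(π * qf (B⁻¹).transpose (zv k.1)) * s ^ 2)
        Filter.atTop Filter.atBot :=
      h1.const_mul_atTop_of_neg (by
        have := Real.pi_pos
        have := mul_pos this hpos
        linarith)
    refine h2.congr fun s => ?_
    ring
  · filter_upwards [Filter.eventually_ge_atTop (1 : ℝ)] with s hs k
    rw [Real.norm_of_nonneg (Real.exp_pos _).le]
    refine Real.exp_le_exp.2 ?_
    have h := qf_nonneg (B⁻¹).transpose (zv k.1)
    have : π * 1 ^ 2 ≤ π * s ^ 2 := by gcongr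
    nlinarith

lemma dm_le {n : ℕ} (B : Matrix (Fin n) (Fin n) ℝ) (hB : IsUnit B.det) {ε s : ℝ}
    (hε : 0 < ε) (hs0 : 0 < s) (hs : smoothingParam B ε ≤ s) : dm B s ≤ ε := by
  have hne : {s : ℝ | 0 < s ∧ rhoOnSet (1 / s) (dualLattice B \ {0}) ≤ ε}.Nonempty := by
    have h1 := (dm_tendsto B hB).eventually (ge_mem_nhds hε)
    obtain ⟨t, ht, ht0⟩ := (h1.and (Filter.eventually_gt_atTop 0)).exists
    exact ⟨t, ht0, by rw [rho_dual B hB]; exact ht⟩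
  have hgt : ∀ t, s < t → dm B t ≤ ε := by
    intro t ht
    obtain ⟨r, ⟨hr0, hr⟩, hrt⟩ := exists_lt_of_csInf_lt hne (lt_of_le_of_lt hs ht)
    rw [rho_dual B hB] at hr
    exact (dm_anti B hB hr0 hrt.le).trans hr
  refine (dm_summable B hB hs0).tsum_le_of_sum_le fun S => ?_
  let g : ℝ → ℝ := fun t => ∑ k ∈ S, Real.exp (-(π * t ^ 2) * qf (B⁻¹).transpose (zv k.1))
  have hg : Continuous g := by
    simp only [g]
    fun_prop
  have hlim : Filter.Tendsto g (nhdsWithin s (Set.Ioi s)) (nhds (g s)) :=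
    hg.continuousAt.tendsto.mono_left nhdsWithin_le_nhds
  refine le_of_tendsto hlim ?_
  filter_upwards [self_mem_nhdsWithin] with t ht
  exact ((dm_summable B hB (hs0.trans ht)).sum_le_tsum S
    (fun _ _ => (Real.exp_pos _).le)).trans (hgt t ht)

lemma rhoCentered_eq {n : ℕ} (B : Matrix (Fin n) (Fin n) ℝ) (hB : IsUnit B.det) (s : ℝ)
    (v : Fin n → ℝ) : rhoCentered B s (-v) = pg B (π / s ^ 2) (B⁻¹.mulVec v) := by
  unfold rhoCentered pg
  refine tsum_congr fun z => ?_
  have : B.mulVec (B⁻¹.mulVec v + zv z) = v + B.mulVec (zv z) := by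
    rw [Matrix.mulVec_add, Matrix.mulVec_mulVec, Matrix.mul_nonsing_inv B hB, Matrix.one_mulVec]
  simp only [qf, this]
  congr 1
  have h : ∑ i, ((B.mulVec fun j => (z j : ℝ)) i - (-v) i) ^ 2 =
      ∑ i, (v + B.mulVec (zv z)) i ^ 2 := by
    refine Finset.sum_congr rfl fun i _ => ?_
    simp only [Pi.neg_apply, Pi.add_apply]
    unfold zv
    ring
  rw [h]
  ring

lemma pg_bounds {n : ℕ} (B : Matrix (Fin n) (Fin n) ℝ) (hB : IsUnit B.det) {s : ℝ}
    (hs : 0 < s) (t : Fin n → ℝ) :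
    pg B (π / s ^ 2) 0 = pcst B (π / s ^ 2) * (1 + dm B s) ∧
    pg B (π / s ^ 2) t ≤ pg B (π / s ^ 2) 0 ∧
    pcst B (π / s ^ 2) * (1 - dm B s) ≤ pg B (π / s ^ 2) t := by
  have ha : 0 < π / s ^ 2 := by positivity
  have hpa : π ^ 2 / (π / s ^ 2) = π * s ^ 2 := by
    field_simp
  have hK : 0 ≤ pcst B (π / s ^ 2) := by
    unfold pcst
    positivity
  have hp := poisson B hB ha
  rw [hpa] at hp
  set E : (Fin n → ℤ) → ℝ := fun k => Real.exp (-(π * s ^ 2) * qf (B⁻¹).transpose (zv k)) with hE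
  have hEs : Summable E := summable_qf _ (isUnit_dual B hB) (by positivity)
  have hE0 : E 0 = 1 := by simp [hE, zv_zero, qf_zero]
  have hT : HasSum E (1 + dm B s) := by
    have h1 := hEs.hasSum
    have h2 : ∑' k, E k = 1 + dm B s := by
      rw [← Summable.tsum_add_tsum_compl (s := {0}) (hEs.subtype _) (hEs.subtype _),
        tsum_singleton, hE0]
      rfl
    rwa [h2] at h1
  have h0 : HasSum (fun k => pcst B (π / s ^ 2) * E k) (pg B (π / s ^ 2) 0) := by
    have := hp 0
    simpa [hE] using this
  have hT' := hT.mul_left (pcst B (π / s ^ 2))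
  have he := h0.unique hT'
  refine ⟨he, ?_, ?_⟩
  · refine hasSum_le (fun k => ?_) (hp t) h0
    refine mul_le_mul_of_nonneg_left ?_ hK
    exact mul_le_of_le_one_right (Real.exp_pos _).le (Real.cos_le_one _)
  · have hd : HasSum (fun k : Fin n → ℤ => if k = 0 then (2 : ℝ) else 0) 2 :=
      hasSum_ite_eq 0 2
    have hl := (hd.sub hT).mul_left (pcst B (π / s ^ 2))
    have h2 : (2 : ℝ) - (1 + dm B s) = 1 - dm B s := by ring
    rw [h2] at hl
    refine hasSum_le (fun k => mul_le_mul_of_nonneg_left ?_ hK) hl (hp t)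
    by_cases hk : k = 0
    · subst hk
      rw [hE0]
      simp [zv_zero, qf_zero]
      norm_num
    · simp only [hk, if_false, zero_sub]
      have h3 : 0 < E k := Real.exp_pos _
      have h4 := Real.neg_one_le_cos (2 * π * ∑ i, (k i : ℝ) * t i)
      nlinarith

/-- If `s ≥ η_ε(Λ)` with `0 < ε < 1/2`, then for every shift `v`,
`ρ_{s,0}(Λ)/ρ_{s,−v}(Λ) ∈ [1, (1+ε)/(1−ε)] ⊆ [1, 1+4ε]`. -/
theorem stmt13 (n : ℕ) (B : Matrix (Fin n) (Fin n) ℝ) (hB : IsUnit B.det)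
    (ε : ℝ) (hε0 : 0 < ε) (hε : ε < 1 / 2) (s : ℝ) (hs : smoothingParam B ε ≤ s)
    (hs0 : 0 < s) (v : Fin n → ℝ) :
    (1 ≤ rhoCentered B s 0 / rhoCentered B s (-v) ∧
      rhoCentered B s 0 / rhoCentered B s (-v) ≤ (1 + ε) / (1 - ε)) ∧
    (1 + ε) / (1 - ε) ≤ 1 + 4 * ε := by
  have hd := dm_le B hB hε0 hs0 hs
  obtain ⟨h0, hle, hge⟩ := pg_bounds B hB hs0 (B⁻¹.mulVec v)
  have e1 : rhoCentered B s 0 = pg B (π / s ^ 2) 0 := by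
    have := rhoCentered_eq B hB s 0
    rwa [neg_zero, Matrix.mulVec_zero] at this
  rw [e1, rhoCentered_eq B hB s v]
  have hK : 0 < pcst B (π / s ^ 2) := by
    unfold pcst
    have : B.det⁻¹ ≠ 0 := inv_ne_zero hB.ne_zero
    positivity
  have hp : pcst B (π / s ^ 2) * (1 - ε) ≤ pg B (π / s ^ 2) (B⁻¹.mulVec v) :=
    le_trans (mul_le_mul_of_nonneg_left (by linarith) hK.le) hge
  have hpos : 0 < pg B (π / s ^ 2) (B⁻¹.mulVec v) :=
    lt_of_lt_of_le (mul_pos hK (by linarith)) hp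
  refine ⟨⟨?_, ?_⟩, ?_⟩
  · rw [one_le_div hpos]
    exact hle
  · rw [div_le_div_iff₀ hpos (by linarith), h0]
    have h1 : pcst B (π / s ^ 2) * (1 + dm B s) * (1 - ε) ≤
        (1 + ε) * (pcst B (π / s ^ 2) * (1 - ε)) := by
      have : pcst B (π / s ^ 2) * (1 + dm B s) ≤ pcst B (π / s ^ 2) * (1 + ε) :=
        mul_le_mul_of_nonneg_left (by linarith) hK.le
      have := mul_le_mul_of_nonneg_right this (show 0 ≤ 1 - ε by linarith)
      linarith
    exact h1.trans (mul_le_mul_of_nonneg_left hp (by linarith))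
  · rw [div_le_iff₀ (by linarith)]
    nlinarith

end
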